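/- arXiv:1204.4290 — 4 statements merged into one kernel-verified Lean document; each statement's English description precedes it below -/
import Mathlib

section
/- Curvature of the canonical connection: on U = {x ∈ ℝ⁴ : x·x ≠ 0}, let Γ^μ_{νλ}(x) = −(x_ν δ^μ_λ + δ^μ_ν x_λ)/(x·x) and define the curvature tensor R^σ_{μνρ} = ∂_ν Γ^σ_{μρ} − ∂_ρ Γ^σ_{μν} + Γ^σ_{τν} Γ^τ_{μρ} − Γ^σ_{τρ} Γ^τ_{μν}. Then for all x ∈ U, R^σ_{μνρ}(x) = ( δ^σ_ρ (x_μ x_ν − (x·x) η_{μν}) − δ^σ_ν (x_μ x_ρ − (x·x) η_{μρ}) ) / (x·x)², i.e. R^σ_{μνρ} = δ^σ_ρ ĝ_{μν} − δ^σ_ν ĝ_{μρ} where ĝ_{μν}(x) = (x_μ x_ν − (x·x) η_{μν})/(x·x)². -/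
noncomputable section

open scoped BigOperators

/-- The Minkowski metric η = diag(1,−1,−1,−1), as a function of two indices. -/
def etaF : Fin 4 → Fin 4 → ℝ := fun μ ν => if μ = ν then (if μ = 0 then 1 else -1) else 0

/-- The Minkowski product x·y = η_{μν} x^μ y^ν. -/
def mdot (x y : Fin 4 → ℝ) : ℝ := ∑ μ, ∑ ν, etaF μ ν * x μ * y ν

/-- The lowered index x_μ = η_{μν} x^ν. -/
def lowr (x : Fin 4 → ℝ) (μ : Fin 4) : ℝ := ∑ ν, etaF μ ν * x ν

/-- The partial derivative ∂_λ f (x). -/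
def pdv (f : (Fin 4 → ℝ) → ℝ) (lam : Fin 4) (x : Fin 4 → ℝ) : ℝ :=
  fderiv ℝ f x (Pi.single lam 1)

/-- A ∈ 𝔰𝔬(1,3), i.e. Aᵀη + ηA = 0, written componentwise. -/
def so13 (A : Fin 4 → Fin 4 → ℝ) : Prop :=
  ∀ μ ν, (∑ κ, A κ μ * etaF κ ν) + (∑ κ, etaF μ κ * A κ ν) = 0

/-- The 𝔭₂ vector field ξ(x) = A x + (b·x) x. -/
def xiP2 (A : Fin 4 → Fin 4 → ℝ) (b : Fin 4 → ℝ) (x : Fin 4 → ℝ) : Fin 4 → ℝ :=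
  fun μ => (∑ ν, A μ ν * x ν) + mdot b x * x μ

/-- Lie derivative of a covariant symmetric 2-tensor field g along a vector field ξ:
  (ℒ_ξ g)_{μν} = ξ^λ ∂_λ g_{μν} + g_{μλ} ∂_ν ξ^λ + g_{λν} ∂_μ ξ^λ. -/
def lieG (ξf : (Fin 4 → ℝ) → Fin 4 → ℝ) (g : (Fin 4 → ℝ) → Fin 4 → Fin 4 → ℝ)
    (x : Fin 4 → ℝ) (μ ν : Fin 4) : ℝ :=
  (∑ lam, ξf x lam * pdv (fun y => g y μ ν) lam x)
  + (∑ lam, g x μ lam * pdv (fun y => ξf y lam) ν x)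
  + (∑ lam, g x lam ν * pdv (fun y => ξf y lam) μ x)

/-- Lie derivative of a contravariant symmetric 2-tensor field h along a vector field ξ:
  (ℒ_ξ h)^{μν} = ξ^λ ∂_λ h^{μν} − h^{μλ} ∂_λ ξ^ν − h^{λν} ∂_λ ξ^μ. -/
def lieH (ξf : (Fin 4 → ℝ) → Fin 4 → ℝ) (h : (Fin 4 → ℝ) → Fin 4 → Fin 4 → ℝ)
    (x : Fin 4 → ℝ) (μ ν : Fin 4) : ℝ :=
  (∑ lam, ξf x lam * pdv (fun y => h y μ ν) lam x)
  - (∑ lam, h x μ lam * pdv (fun y => ξf y ν) lam x)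
  - (∑ lam, h x lam ν * pdv (fun y => ξf y μ) lam x)

/-- Lie derivative of a connection Γ^μ_{νρ} along a vector field ξ ([ℒ_ξ, ∇]):
  ξ^λ ∂_λ Γ^μ_{νρ} − Γ^λ_{νρ} ∂_λ ξ^μ + Γ^μ_{λρ} ∂_ν ξ^λ + Γ^μ_{νλ} ∂_ρ ξ^λ + ∂_ν ∂_ρ ξ^μ. -/
def lieConn (ξf : (Fin 4 → ℝ) → Fin 4 → ℝ)
    (Γ : (Fin 4 → ℝ) → Fin 4 → Fin 4 → Fin 4 → ℝ)
    (x : Fin 4 → ℝ) (μ ν ρ : Fin 4) : ℝ :=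
  (∑ lam, ξf x lam * pdv (fun y => Γ y μ ν ρ) lam x)
  - (∑ lam, Γ x lam ν ρ * pdv (fun y => ξf y μ) lam x)
  + (∑ lam, Γ x μ lam ρ * pdv (fun y => ξf y lam) ν x)
  + (∑ lam, Γ x μ ν lam * pdv (fun y => ξf y lam) ρ x)
  + pdv (fun y => pdv (fun z => ξf z μ) ρ y) ν x

/-- The canonical degenerate covariant metric g_{μν}(x) = (x_μ x_ν − (x·x) η_{μν})/(x·x)². -/
def gC (x : Fin 4 → ℝ) (μ ν : Fin 4) : ℝ :=
  (lowr x μ * lowr x ν - mdot x x * etaF μ ν) / (mdot x x) ^ 2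

/-- The canonical degenerate contravariant metric h^{μν}(x) = (x·x) x^μ x^ν. -/
def hC (x : Fin 4 → ℝ) (μ ν : Fin 4) : ℝ := mdot x x * x μ * x ν

/-- The canonical connection Γ^μ_{νλ}(x) = −(x_ν δ^μ_λ + δ^μ_ν x_λ)/(x·x). -/
def GammaC (x : Fin 4 → ℝ) (μ ν lam : Fin 4) : ℝ :=
  -(lowr x ν * (if μ = lam then 1 else 0) + (if μ = ν then 1 else 0) * lowr x lam) / mdot x x

/-- The curvature tensor of the canonical connection:
R^σ_{μνρ} = ∂_ν Γ^σ_{μρ} − ∂_ρ Γ^σ_{μν} + Γ^σ_{τν} Γ^τ_{μρ} − Γ^σ_{τρ} Γ^τ_{μν}. -/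
def RiemC (x : Fin 4 → ℝ) (σ μ ν ρ : Fin 4) : ℝ :=
  pdv (fun y => GammaC y σ μ ρ) ν x - pdv (fun y => GammaC y σ μ ν) ρ x
    + (∑ τ, GammaC x σ τ ν * GammaC x τ μ ρ)
    - (∑ τ, GammaC x σ τ ρ * GammaC x τ μ ν)

lemma mdot_self_eq (x : Fin 4 → ℝ) : mdot x x = ∑ μ, lowr x μ * x μ := by
  unfold mdot lowr
  refine Finset.sum_congr rfl fun μ _ => ?_
  rw [Finset.sum_mul]
  exact Finset.sum_congr rfl fun ν _ => by ring

lemma etaF_symm (μ ν : Fin 4) : etaF μ ν = etaF ν μ := by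
  unfold etaF
  by_cases h : μ = ν
  · subst h; rfl
  · rw [if_neg h, if_neg (Ne.symm h)]

lemma line_lowr (x : Fin 4 → ℝ) (μ ν : Fin 4) (t : ℝ) :
    lowr (x + t • Pi.single ν 1) μ = lowr x μ + t * etaF μ ν := by
  unfold lowr
  simp only [Pi.add_apply, Pi.smul_apply, smul_eq_mul, mul_add, Finset.sum_add_distrib]
  congr 1
  rw [Finset.sum_eq_single ν]
  · simp [mul_comm]
  · intro b _ hb
    simp [hb]
  · simp

lemma line_mdot (x : Fin 4 → ℝ) (ν : Fin 4) (t : ℝ) :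
    mdot (x + t • Pi.single ν 1) (x + t • Pi.single ν 1)
      = mdot x x + t * (2 * lowr x ν) + t ^ 2 * etaF ν ν := by
  have h : ∑ μ, etaF μ ν * x μ = lowr x ν := by
    unfold lowr
    exact Finset.sum_congr rfl fun μ _ => by rw [etaF_symm]
  rw [mdot_self_eq, mdot_self_eq]
  simp only [line_lowr, Pi.add_apply, Pi.smul_apply, smul_eq_mul, mul_add, add_mul,
    Finset.sum_add_distrib]
  have h1 : ∀ f : Fin 4 → ℝ, ∑ i, f i * (t * (Pi.single ν (1:ℝ) : Fin 4 → ℝ) i) = f ν * t := by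
    intro f
    rw [Finset.sum_eq_single ν]
    · simp
    · intro b _ hb
      simp [hb]
    · simp
  have h2 : ∑ i, t * etaF i ν * x i = t * lowr x ν := by
    rw [← h, Finset.mul_sum]
    exact Finset.sum_congr rfl fun μ _ => by ring
  rw [h1, h1 (fun i => t * etaF i ν), h2]
  ring

lemma diff_lowr (x : Fin 4 → ℝ) (μ : Fin 4) :
    DifferentiableAt ℝ (fun y => lowr y μ) x := by
  unfold lowr
  fun_prop

lemma diff_mdot (x : Fin 4 → ℝ) : DifferentiableAt ℝ (fun y => mdot y y) x := by
  unfold mdot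
  fun_prop

lemma pdv_Gamma (x : Fin 4 → ℝ) (hx : mdot x x ≠ 0) (σ μ ρ ν : Fin 4) :
    pdv (fun y => GammaC y σ μ ρ) ν x =
      (-(etaF μ ν * (if σ = ρ then 1 else 0) + (if σ = μ then 1 else 0) * etaF ρ ν) * mdot x x
        + (lowr x μ * (if σ = ρ then 1 else 0) + (if σ = μ then 1 else 0) * lowr x ρ)
          * (2 * lowr x ν)) / (mdot x x) ^ 2 := by
  have hd : DifferentiableAt ℝ (fun y => GammaC y σ μ ρ) x := by
    unfold GammaC
    simp only [div_eq_mul_inv]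
    exact ((((diff_lowr x μ).mul_const _).fun_add ((diff_lowr x ρ).const_mul _)).fun_neg).fun_mul
      ((diff_mdot x).fun_inv hx)
  unfold pdv
  rw [← hd.lineDeriv_eq_fderiv, lineDeriv]
  apply HasDerivAt.deriv
  unfold GammaC
  simp only [line_lowr, line_mdot]
  have hl : ∀ a b : ℝ, HasDerivAt (fun t : ℝ => a + t * b) b 0 := fun a b => by
    simpa using ((hasDerivAt_id (0:ℝ)).mul_const b).const_add a
  have hq : HasDerivAt (fun t : ℝ => mdot x x + t * (2 * lowr x ν) + t ^ 2 * etaF ν ν)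
      (2 * lowr x ν) 0 := by
    simpa using (hl (mdot x x) (2 * lowr x ν)).fun_add
      (((hasDerivAt_id (0:ℝ)).pow 2).mul_const (etaF ν ν))
  have := (((hl (lowr x μ) (etaF μ ν)).mul_const (if σ = ρ then (1:ℝ) else 0)).fun_add
    ((hl (lowr x ρ) (etaF ρ ν)).const_mul (if σ = μ then (1:ℝ) else 0))).fun_neg.fun_div hq (by simpa using hx)
  refine this.congr_deriv ?_
  simp only [zero_mul, add_zero, ne_eq, OfNat.ofNat_ne_zero,
    not_false_eq_true, zero_pow]
  ring

lemma sum_Gamma (x : Fin 4 → ℝ) (σ μ ν ρ : Fin 4) :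
    ∑ τ, GammaC x σ τ ν * GammaC x τ μ ρ =
      (2 * (if σ = ν then 1 else 0) * lowr x μ * lowr x ρ
        + (if σ = ρ then 1 else 0) * lowr x μ * lowr x ν
        + (if σ = μ then 1 else 0) * lowr x ν * lowr x ρ) / (mdot x x) ^ 2 := by
  have e : ∀ τ, GammaC x σ τ ν * GammaC x τ μ ρ =
      ((if τ = ρ then lowr x τ * ((if σ = ν then 1 else 0) * lowr x μ) else 0)
      + (if τ = μ then lowr x τ * ((if σ = ν then 1 else 0) * lowr x ρ) else 0)
      + (if σ = τ then lowr x ν * ((if τ = ρ then 1 else 0) * lowr x μ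
          + (if τ = μ then 1 else 0) * lowr x ρ) else 0)) * ((mdot x x) ^ 2)⁻¹ := by
    intro τ
    unfold GammaC
    rw [div_mul_div_comm, ← pow_two, div_eq_mul_inv]
    congr 1
    split_ifs <;> ring
  simp only [e]
  rw [← Finset.sum_mul, div_eq_mul_inv]
  congr 1
  simp only [Finset.sum_add_distrib, Finset.sum_ite_eq, Finset.sum_ite_eq', Finset.mem_univ,
    if_true]
  ring

/-- Curvature of the canonical connection: R^σ_{μνρ} = δ^σ_ρ ĝ_{μν} − δ^σ_ν ĝ_{μρ},
where ĝ_{μν}(x) = (x_μ x_ν − (x·x) η_{μν})/(x·x)². -/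
theorem stmt_12 :
    ∀ x : Fin 4 → ℝ, mdot x x ≠ 0 → ∀ σ μ ν ρ : Fin 4,
      RiemC x σ μ ν ρ =
        ((if σ = ρ then 1 else 0) * (lowr x μ * lowr x ν - mdot x x * etaF μ ν)
          - (if σ = ν then 1 else 0) * (lowr x μ * lowr x ρ - mdot x x * etaF μ ρ))
          / (mdot x x) ^ 2 := by
  intro x hx σ μ ν ρ
  unfold RiemC
  rw [pdv_Gamma x hx, pdv_Gamma x hx, sum_Gamma, sum_Gamma, etaF_symm ρ ν]
  field_simp
  ring
end
end

section
/- Ricci curvature of the canonical connection: on U = {x ∈ ℝ⁴ : x·x ≠ 0}, let Γ^μ_{νλ}(x) = −(x_ν δ^μ_λ + δ^μ_ν x_λ)/(x·x), with curvature R^σ_{μνρ} = ∂_ν Γ^σ_{μρ} − ∂_ρ Γ^σ_{μν} + Γ^σ_{τν} Γ^τ_{μρ} − Γ^σ_{τρ} Γ^τ_{μν} and Ricci tensor R_{μν} = R^σ_{μνσ} (sum over σ). Then for all x ∈ U, R_{μν}(x) = 3 (x_μ x_ν − (x·x) η_{μν}) / (x·x)², i.e. R_{μν} = 3 ĝ_{μν}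 where ĝ_{μν}(x) = (x_μ x_ν − (x·x) η_{μν})/(x·x)². -/
noncomputable section

open scoped BigOperators

theorem aux_lowr (x : Fin 4 → ℝ) (μ : Fin 4) : lowr x μ = etaF μ μ * x μ := by
  unfold lowr
  rw [Finset.sum_eq_single μ]
  · intro b _ hb
    simp [etaF, hb.symm]
  · simp

theorem aux_mdot (x : Fin 4 → ℝ) :
    mdot x x = x 0 * x 0 - x 1 * x 1 - x 2 * x 2 - x 3 * x 3 := by
  simp [mdot, etaF, Fin.sum_univ_four]
  ring

theorem aux_hasLowr (x : Fin 4 → ℝ) (μ : Fin 4) :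
    HasFDerivAt (fun y => lowr y μ)
      (etaF μ μ • (ContinuousLinearMap.proj μ : (Fin 4 → ℝ) →L[ℝ] ℝ)) x := by
  simp only [aux_lowr]
  exact (hasFDerivAt_apply μ x).const_mul _

theorem aux_hasMdot (x : Fin 4 → ℝ) : ∃ L : (Fin 4 → ℝ) →L[ℝ] ℝ,
    HasFDerivAt (fun y => mdot y y) L x ∧ ∀ ρ, L (Pi.single ρ 1) = 2 * lowr x ρ := by
  have h := fun i : Fin 4 => (hasFDerivAt_apply (𝕜 := ℝ) (F' := fun _ => ℝ) i x)
  simp only [aux_mdot]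
  refine ⟨_, ((((h 0).mul (h 0)).sub ((h 1).mul (h 1))).sub ((h 2).mul (h 2))).sub
    ((h 3).mul (h 3)), ?_⟩
  intro ρ
  rw [aux_lowr]
  fin_cases ρ <;> simp [etaF] <;> ring

theorem aux_pdv (x : Fin 4 → ℝ) (hx : mdot x x ≠ 0) (μ ν lam ρ : Fin 4) :
    pdv (fun y => GammaC y μ ν lam) ρ x =
      -(etaF ν ρ * (if μ = lam then 1 else 0) + (if μ = ν then 1 else 0) * etaF lam ρ) / mdot x x
      + (lowr x ν * (if μ = lam then 1 else 0) + (if μ = ν then 1 else 0) * lowr x lam)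
        * (2 * lowr x ρ) / mdot x x ^ 2 := by
  obtain ⟨L, hL, hL2⟩ := aux_hasMdot x
  have he : ∀ a b : Fin 4, etaF a a * (Pi.single b (1:ℝ) : Fin 4 → ℝ) a = etaF a b := by
    intro a b
    by_cases h : a = b
    · subst h; simp
    · simp [etaF, h]
  have hn := (((aux_hasLowr x ν).mul_const (if μ = lam then (1:ℝ) else 0)).add
    ((aux_hasLowr x lam).const_mul (if μ = ν then (1:ℝ) else 0))).neg
  have hinv := HasDerivAt.comp_hasFDerivAt (f := fun y => mdot y y) x (hasDerivAt_inv hx) hL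
  have h := hn.mul hinv
  have h2 : HasFDerivAt (fun y => GammaC y μ ν lam) _ x := h
  unfold pdv
  rw [h2.fderiv]
  simp only [ContinuousLinearMap.add_apply, ContinuousLinearMap.smul_apply,
    ContinuousLinearMap.neg_apply, ContinuousLinearMap.proj_apply, smul_eq_mul, hL2, he,
    Function.comp, Pi.neg_apply, Pi.add_apply]
  field_simp
  ring

set_option maxHeartbeats 4000000 in
/-- Ricci curvature of the canonical connection: R_{μν} = R^σ_{μνσ} = 3 ĝ_{μν},
where ĝ_{μν}(x) = (x_μ x_ν − (x·x) η_{μν})/(x·x)². -/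
theorem stmt_13 :
    ∀ x : Fin 4 → ℝ, mdot x x ≠ 0 → ∀ μ ν : Fin 4,
      (∑ σ, RiemC x σ μ ν σ) =
        3 * (lowr x μ * lowr x ν - mdot x x * etaF μ ν) / (mdot x x) ^ 2 := by
  intro x hx μ ν
  simp only [RiemC, aux_pdv x hx]
  simp only [GammaC, aux_lowr]
  generalize mdot x x = s at hx ⊢
  fin_cases μ <;> fin_cases ν <;>
    (simp [Fin.sum_univ_four, etaF]; field_simp; ring)
end
end

section
/- Lie algebra structure of the second Poincaré algebra 𝔭₂: for b ∈ ℝ⁴ let T_b be the vector field on ℝ⁴ given by T_b(x) = (b·x) x, and for a 4×4 real matrix A with Aᵀη + ηA = 0 let L_A(x) = A x. With the Lie bracket of vector fields [X,Y](x) = DY(x)(X(x)) − DX(x)(Y(x)) (D denoting the total derivative), the following hold for all b, b' ∈ ℝ⁴ and all A, B ∈ 𝔰𝔬(1,3): (i) [T_b, T_{b'}] = 0 (the pseudo-translations commute); (ii) [L_A, T_b] = T_{−A b}; (iii) [L_A, L_B] = L_{BA − AB}. Consequently the set of vector fields {x ↦ A x + (b·x) x : A ∈ 𝔰𝔬(1,3),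 b ∈ ℝ⁴} is closed under the Lie bracket and the pseudo-translations {T_b : b ∈ ℝ⁴} form an abelian ideal in it, so 𝔭₂ realizes the Lie algebra 𝔦𝔰𝔬(1,3). -/
noncomputable section

open scoped BigOperators

/-- The Lie bracket of vector fields on ℝ⁴: [X,Y](x) = DY(x)(X(x)) − DX(x)(Y(x)). -/
def vB (X Y : (Fin 4 → ℝ) → (Fin 4 → ℝ)) : (Fin 4 → ℝ) → (Fin 4 → ℝ) :=
  fun x => fderiv ℝ Y x (X x) - fderiv ℝ X x (Y x)

/-- The pseudo-translation vector field T_b(x) = (b·x) x. -/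
def Tb (b : Fin 4 → ℝ) : (Fin 4 → ℝ) → (Fin 4 → ℝ) := fun x => mdot b x • x

/-- The linear (Lorentz) vector field L_A(x) = A x. -/
def LvA (A : Fin 4 → Fin 4 → ℝ) : (Fin 4 → ℝ) → (Fin 4 → ℝ) :=
  fun x μ => ∑ ν, A μ ν * x ν

theorem mdot_expand (x y : Fin 4 → ℝ) :
    mdot x y = x 0 * y 0 - x 1 * y 1 - x 2 * y 2 - x 3 * y 3 := by
  simp [mdot, etaF, Fin.sum_univ_four]
  ring

/-- `LvA A` as a linear map. -/
def LvAlin (A : Fin 4 → Fin 4 → ℝ) : (Fin 4 → ℝ) →ₗ[ℝ] (Fin 4 → ℝ) where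
  toFun := LvA A
  map_add' x y := by
    ext μ
    simp only [LvA, Pi.add_apply, mul_add, Finset.sum_add_distrib]
  map_smul' c x := by
    ext μ
    simp only [LvA, Pi.smul_apply, smul_eq_mul, Finset.mul_sum, RingHom.id_apply]
    exact Finset.sum_congr rfl fun _ _ => by ring

/-- `mdot b` as a linear map. -/
def mdotlin (b : Fin 4 → ℝ) : (Fin 4 → ℝ) →ₗ[ℝ] ℝ where
  toFun := mdot b
  map_add' x y := by
    simp only [mdot_expand, Pi.add_apply]
    ring
  map_smul' c x := by
    simp only [mdot_expand, Pi.smul_apply, smul_eq_mul, RingHom.id_apply]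
    ring

theorem LvA_hasFDerivAt (A : Fin 4 → Fin 4 → ℝ) (x : Fin 4 → ℝ) :
    HasFDerivAt (LvA A) (LvAlin A).toContinuousLinearMap x :=
  (LvAlin A).toContinuousLinearMap.hasFDerivAt

theorem mdot_hasFDerivAt (b x : Fin 4 → ℝ) :
    HasFDerivAt (mdot b) (mdotlin b).toContinuousLinearMap x :=
  (mdotlin b).toContinuousLinearMap.hasFDerivAt

theorem Tb_hasFDerivAt (b x : Fin 4 → ℝ) :
    HasFDerivAt (Tb b) (mdot b x • ContinuousLinearMap.id ℝ (Fin 4 → ℝ) +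
      (mdotlin b).toContinuousLinearMap.smulRight x) x :=
  (mdot_hasFDerivAt b x).smul (hasFDerivAt_id x)

theorem fderiv_LvA (A : Fin 4 → Fin 4 → ℝ) (x v : Fin 4 → ℝ) :
    fderiv ℝ (LvA A) x v = LvA A v := by
  rw [(LvA_hasFDerivAt A x).fderiv]
  rfl

theorem fderiv_Tb (b x v : Fin 4 → ℝ) :
    fderiv ℝ (Tb b) x v = mdot b x • v + mdot b v • x := by
  rw [(Tb_hasFDerivAt b x).fderiv]
  rfl

theorem fderiv_LvA_add_Tb (A : Fin 4 → Fin 4 → ℝ) (b x v : Fin 4 → ℝ) :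
    fderiv ℝ (fun x => LvA A x + Tb b x) x v =
      LvA A v + (mdot b x • v + mdot b v • x) := by
  rw [fderiv_fun_add (LvA_hasFDerivAt A x).differentiableAt
    (Tb_hasFDerivAt b x).differentiableAt, ← fderiv_LvA A x v, ← fderiv_Tb b x v]
  rfl

theorem LvA_add (A : Fin 4 → Fin 4 → ℝ) (x y : Fin 4 → ℝ) :
    LvA A (x + y) = LvA A x + LvA A y := (LvAlin A).map_add x y

theorem LvA_smul (A : Fin 4 → Fin 4 → ℝ) (c : ℝ) (x : Fin 4 → ℝ) :
    LvA A (c • x) = c • LvA A x := (LvAlin A).map_smul c x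

theorem mdot_add (b x y : Fin 4 → ℝ) : mdot b (x + y) = mdot b x + mdot b y :=
  (mdotlin b).map_add x y

theorem mdot_smul (b : Fin 4 → ℝ) (c : ℝ) (x : Fin 4 → ℝ) :
    mdot b (c • x) = c * mdot b x := (mdotlin b).map_smul c x

theorem mdot_comm' (x y : Fin 4 → ℝ) : mdot x y = mdot y x := by
  simp only [mdot_expand]
  ring

theorem mdot_sub_left (b c x : Fin 4 → ℝ) : mdot (b - c) x = mdot b x - mdot c x := by
  simp only [mdot_expand, Pi.sub_apply]
  ring

/-- The sign of the diagonal entries of the metric. -/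
def sg (μ : Fin 4) : ℝ := if μ = 0 then 1 else -1

theorem sg_sq (μ : Fin 4) : sg μ * sg μ = 1 := by
  unfold sg
  split_ifs <;> norm_num

theorem so13_iff (A : Fin 4 → Fin 4 → ℝ) :
    so13 A ↔ ∀ μ ν, A ν μ * sg ν + sg μ * A μ ν = 0 := by
  simp [so13, etaF, sg]

theorem mdot_sg (x y : Fin 4 → ℝ) : mdot x y = ∑ μ, sg μ * x μ * y μ := by
  simp [mdot, etaF, sg]

/-- Elements of the Lorentz algebra are skew for the Minkowski product. -/
theorem mdot_skew (A : Fin 4 → Fin 4 → ℝ) (hA : so13 A) (b x : Fin 4 → ℝ) :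
    mdot b (LvA A x) = - mdot (LvA A b) x := by
  rw [so13_iff] at hA
  rw [mdot_sg, mdot_sg, ← Finset.sum_neg_distrib]
  simp only [LvA, Finset.mul_sum, Finset.sum_mul, ← Finset.sum_neg_distrib]
  rw [Finset.sum_comm]
  refine Finset.sum_congr rfl fun i _ => Finset.sum_congr rfl fun j _ => ?_
  linear_combination (b j * x i) * hA i j

theorem LvA_comm (A B : Fin 4 → Fin 4 → ℝ) (x : Fin 4 → ℝ) :
    LvA (fun μ ν => (∑ κ, B μ κ * A κ ν) - ∑ κ, A μ κ * B κ ν) x =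
      LvA B (LvA A x) - LvA A (LvA B x) := by
  ext μ
  simp only [LvA, Pi.sub_apply, Fin.sum_univ_four]
  ring

theorem so13_comm (A B : Fin 4 → Fin 4 → ℝ) (hA : so13 A) (hB : so13 B) :
    so13 (fun μ ν => (∑ κ, B μ κ * A κ ν) - ∑ κ, A μ κ * B κ ν) := by
  rw [so13_iff] at *
  intro μ ν
  simp only [sub_mul, mul_sub, Finset.sum_mul, Finset.mul_sum, ← Finset.sum_sub_distrib,
    ← Finset.sum_add_distrib]
  refine Finset.sum_eq_zero fun k _ => ?_
  linear_combination A k μ * hB k ν - B k μ * hA k ν - B k ν * hA μ k + A k ν * hB μ k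

theorem Tb_neg_LvA (A : Fin 4 → Fin 4 → ℝ) (hA : so13 A) (b x : Fin 4 → ℝ) :
    mdot (fun μ => -(∑ ν, A μ ν * b ν)) x = mdot b (LvA A x) := by
  rw [mdot_skew A hA]
  simp only [mdot_expand, LvA]
  ring

/-- Lie algebra structure of 𝔭₂: the pseudo-translations commute, [L_A, T_b] = T_{−Ab},
[L_A, L_B] = L_{BA−AB}; consequently the 𝔭₂ vector fields are closed under the bracket
and the pseudo-translations form an abelian ideal, realizing 𝔦𝔰𝔬(1,3). -/
theorem stmt_17 :
    (∀ b b' : Fin 4 → ℝ, vB (Tb b) (Tb b') = 0) ∧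
    (∀ (A : Fin 4 → Fin 4 → ℝ) (b : Fin 4 → ℝ), so13 A →
      vB (LvA A) (Tb b) = Tb (fun μ => -(∑ ν, A μ ν * b ν))) ∧
    (∀ A B : Fin 4 → Fin 4 → ℝ, so13 A → so13 B →
      vB (LvA A) (LvA B) =
        LvA (fun μ ν => (∑ κ, B μ κ * A κ ν) - ∑ κ, A μ κ * B κ ν)) ∧
    (∀ (A B : Fin 4 → Fin 4 → ℝ) (b b' : Fin 4 → ℝ), so13 A → so13 B →
      ∃ (C : Fin 4 → Fin 4 → ℝ) (c : Fin 4 → ℝ), so13 C ∧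
        vB (fun x => LvA A x + Tb b x) (fun x => LvA B x + Tb b' x) =
          fun x => LvA C x + Tb c x) ∧
    (∀ (A : Fin 4 → Fin 4 → ℝ) (b b' : Fin 4 → ℝ), so13 A →
      ∃ c : Fin 4 → ℝ, vB (fun x => LvA A x + Tb b' x) (Tb b) = Tb c) := by
  refine ⟨?_, ?_, ?_, ?_, ?_⟩
  · intro b b'
    ext x μ
    simp only [vB, fderiv_Tb]
    simp only [Tb, mdot_smul, Pi.sub_apply, Pi.add_apply, Pi.smul_apply, smul_eq_mul,
      Pi.zero_apply]
    ring
  · intro A b hA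
    ext x μ
    simp only [vB, fderiv_Tb, fderiv_LvA]
    simp only [Tb, Tb_neg_LvA A hA, LvA_smul, Pi.sub_apply, Pi.add_apply, Pi.smul_apply,
      smul_eq_mul]
    ring
  · intro A B _ _
    funext x
    rw [LvA_comm]
    simp only [vB, fderiv_LvA]
  · intro A B b b' hA hB
    refine ⟨_, LvA B b - LvA A b', so13_comm A B hA hB, ?_⟩
    ext x μ
    simp only [LvA_comm, vB, fderiv_LvA_add_Tb]
    simp only [Tb, LvA_add, LvA_smul, mdot_add, mdot_smul, mdot_sub_left,
      mdot_skew A hA, mdot_skew B hB, Pi.sub_apply, Pi.add_apply, Pi.smul_apply,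
      smul_eq_mul]
    ring
  · intro A b b' hA
    refine ⟨fun μ => -(∑ ν, A μ ν * b ν), ?_⟩
    ext x μ
    simp only [vB, fderiv_LvA_add_Tb, fderiv_Tb]
    simp only [Tb, Tb_neg_LvA A hA, LvA_smul, mdot_add, mdot_smul, Pi.sub_apply,
      Pi.add_apply, Pi.smul_apply, smul_eq_mul]
    ring
end
end

section
/- Geodesics of the canonical connection are straight lines: let I ⊆ ℝ be an open interval and γ : I → ℝ⁴ a smooth curve with γ(τ)·γ(τ) ≠ 0 for all τ ∈ I, satisfying the geodesic equation γ̈^μ(τ) + Γ^μ_{νρ}(γ(τ)) γ̇^ν(τ) γ̇^ρ(τ) = 0 for all τ ∈ I and all μ, where Γ^μ_{νρ}(x) = −(x_ν δ^μ_ρ + δ^μ_ν x_ρ)/(x·x) (equivalently, γ̈(τ) = 2 (γ(τ)·γ̇(τ)) γ̇(τ)/(γ(τ)·γ(τ))). Then the quantity γ̇^μ(τ)/(γ(τ)·γ(τ)) is constant on I; i.e. there exists C ∈ ℝ⁴ such that γ̇^μ(τ) = C^μ (γ(τ)·γ(τ)) for all τ ∈ I. In particular C^ν γ̇^μ(τ)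 = C^μ γ̇^ν(τ) for all τ, μ, ν, so all velocity vectors of γ are parallel to the fixed vector C and the trajectory of γ lies on a straight line. -/
noncomputable section

open scoped BigOperators

/-- Geodesics of the canonical connection are straight lines: along any geodesic γ with
γ·γ ≠ 0 the quantity γ̇^μ/(γ·γ) is a constant vector C, so all velocities are parallel
to C and the trajectory lies on a straight line. -/
theorem stmt_18 (I : Set ℝ) (hIopen : IsOpen I) (hIconn : IsPreconnected I)
    (γ : ℝ → Fin 4 → ℝ) (hsmooth : ContDiffOn ℝ (⊤ : ℕ∞) γ I)
    (hne : ∀ τ ∈ I, mdot (γ τ) (γ τ) ≠ 0)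
    (hgeo : ∀ τ ∈ I, ∀ μ,
      deriv (deriv γ) τ μ
        + ∑ ν, ∑ ρ, GammaC (γ τ) μ ν ρ * deriv γ τ ν * deriv γ τ ρ = 0) :
    ∃ C : Fin 4 → ℝ,
      (∀ τ ∈ I, ∀ μ, deriv γ τ μ = C μ * mdot (γ τ) (γ τ)) ∧
      (∀ τ ∈ I, ∀ μ ν, C ν * deriv γ τ μ = C μ * deriv γ τ ν) := by
  have h1 : ∀ τ ∈ I, ∀ μ, HasDerivAt (fun t => γ t μ) (deriv γ τ μ) τ := by
    intro τ hτ μ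
    have hd : DifferentiableAt ℝ γ τ :=
      (hsmooth.differentiableOn (by simp)).differentiableAt (hIopen.mem_nhds hτ)
    exact hasDerivAt_pi.1 hd.hasDerivAt μ
  have h2 : ∀ τ ∈ I, ∀ μ, HasDerivAt (fun t => deriv γ t μ) (deriv (deriv γ) τ μ) τ := by
    intro τ hτ μ
    have hc : ContDiffOn ℝ 1 (deriv γ) I :=
      ((contDiffOn_infty_iff_deriv_of_isOpen hIopen).1 hsmooth).2.of_le (by exact_mod_cast le_top)
    have hd : DifferentiableAt ℝ (deriv γ) τ :=
      (hc.differentiableOn (by simp)).differentiableAt (hIopen.mem_nhds hτ)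
    exact hasDerivAt_pi.1 hd.hasDerivAt μ
  have hm : ∀ x y : Fin 4 → ℝ, mdot x y = x 0 * y 0 - x 1 * y 1 - x 2 * y 2 - x 3 * y 3 := by
    intro x y
    simp [mdot, etaF, Fin.sum_univ_four]
    ring
  have h3 : ∀ τ ∈ I, HasDerivAt (fun t => mdot (γ t) (γ t)) (2 * mdot (γ τ) (deriv γ τ)) τ := by
    intro τ hτ
    simp only [hm]
    have := ((((h1 τ hτ 0).mul (h1 τ hτ 0)).sub ((h1 τ hτ 1).mul (h1 τ hτ 1))).sub
      ((h1 τ hτ 2).mul (h1 τ hτ 2))).sub ((h1 τ hτ 3).mul (h1 τ hτ 3))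
    refine this.congr_deriv ?_
    ring
  have h4 : ∀ τ ∈ I, ∀ μ, deriv (deriv γ) τ μ * mdot (γ τ) (γ τ)
      = 2 * mdot (γ τ) (deriv γ τ) * deriv γ τ μ := by
    intro τ hτ μ
    have h := hgeo τ hτ μ
    have hs : ∑ ν, ∑ ρ, GammaC (γ τ) μ ν ρ * deriv γ τ ν * deriv γ τ ρ
        = -(2 * mdot (γ τ) (deriv γ τ) * deriv γ τ μ) / mdot (γ τ) (γ τ) := by
      simp only [GammaC]
      generalize mdot (γ τ) (γ τ) = q
      rw [hm]
      fin_cases μ <;> simp [lowr, etaF, Fin.sum_univ_four] <;> ring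
    rw [hs] at h
    have hq := hne τ hτ
    field_simp at h
    linarith
  have h5 : ∀ τ ∈ I, ∀ μ, HasDerivAt (fun t => deriv γ t μ / mdot (γ t) (γ t)) 0 τ := by
    intro τ hτ μ
    refine ((h2 τ hτ μ).div (h3 τ hτ) (hne τ hτ)).congr_deriv ?_
    rw [h4 τ hτ μ]
    ring
  have h6 : ∀ μ, ∃ c, ∀ τ ∈ I, deriv γ τ μ / mdot (γ τ) (γ τ) = c := by
    intro μ
    exact hIopen.exists_is_const_of_deriv_eq_zero hIconn
      (fun τ hτ => (h5 τ hτ μ).differentiableAt.differentiableWithinAt)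
      (fun τ hτ => (h5 τ hτ μ).deriv)
  choose C hC' using h6
  have h7 : ∀ τ ∈ I, ∀ μ, deriv γ τ μ = C μ * mdot (γ τ) (γ τ) := by
    intro τ hτ μ
    rw [← hC' μ τ hτ, div_mul_cancel₀ _ (hne τ hτ)]
  refine ⟨C, h7, ?_⟩
  intro τ hτ μ ν
  rw [h7 τ hτ μ, h7 τ hτ ν]
  ring
end
end
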